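/- arXiv:2512.07556 — 2 statements merged into one kernel-verified Lean document; each statement's English description precedes it below -/
import Mathlib

section
/- Suppose that M(x,y) ≥ 0 for all (x,y) with x ∈ [x₋, x₊], |y| ≤ y₀ and F(x) + G(y) ≤ E₀. Then the period function T is monotonically increasing on (0, E₀): for all E₁, E₂ with 0 < E₁ ≤ E₂ < E₀ one has T(E₁) ≤ T(E₂). Symmetrically, if M(x,y) ≤ 0 for all such (x,y), then T is monotonically decreasing on (0, E₀): T(E₁) ≥ T(E₂) for all 0 < E₁ ≤ E₂ < E₀. -/
open Set

/-- The function `M(x,y)` from the main theorem, built from `F` and `G`. -/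
noncomputable def Mfun (F G : ℝ → ℝ) (x y : ℝ) : ℝ :=
  (6 * F x * (deriv (deriv F) x) ^ 2 - 3 * (deriv F x) ^ 2 * deriv (deriv F) x
      - 2 * F x * deriv F x * deriv (deriv (deriv F)) x) * G y * (deriv G y) ^ 2
    + F x * (deriv F x) ^ 2 * deriv (deriv F) x
      * ((deriv G y) ^ 2 - 2 * G y * deriv (deriv G) y)

open MeasureTheory Topology in
theorem hasDerivAt_intervalIntegral_of_continuousOn {f f' : ℝ → ℝ → ℝ} {s : Set ℝ} {a b x₀ : ℝ}
    (hab : a ≤ b) (hs : s ∈ 𝓝 x₀) (hf : ∀ x ∈ s, ContinuousOn (f x) (Icc a b))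
    (hf' : ContinuousOn (Function.uncurry f') (s ×ˢ Icc a b))
    (hd : ∀ x ∈ s, ∀ t ∈ Icc a b, HasDerivAt (fun x => f x t) (f' x t) x) :
    HasDerivAt (fun x => ∫ t in a..b, f x t) (∫ t in a..b, f' x₀ t) x₀ := by
  obtain ⟨ε, hε, hball⟩ := Metric.nhds_basis_closedBall.mem_iff.1 hs
  obtain ⟨C, hC⟩ := ((isCompact_closedBall x₀ ε).prod (isCompact_Icc (a := a) (b := b))
    ).exists_bound_of_continuousOn (hf'.mono (prod_mono hball le_rfl))
  have hx₀ : x₀ ∈ s := mem_of_mem_nhds hs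
  have hf'x : ContinuousOn (f' x₀) (Icc a b) :=
    hf'.comp (f := fun t => (x₀, t)) (by fun_prop) fun t ht => ⟨hx₀, ht⟩
  have hmeas : ∀ {g : ℝ → ℝ}, ContinuousOn g (Icc a b) →
      AEStronglyMeasurable g (volume.restrict (uIoc a b)) := fun hg =>
    (hg.mono (by rw [uIoc_of_le hab]; exact Ioc_subset_Icc_self)).aestronglyMeasurable
      measurableSet_uIoc
  refine (intervalIntegral.hasDerivAt_integral_of_dominated_loc_of_deriv_le (F := f)
    (F' := f') (bound := fun _ => C) (Metric.ball_mem_nhds x₀ hε) ?_ ?_ (hmeas hf'x) ?_ ?_ ?_).2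
  · filter_upwards [hs] with x hx using hmeas (hf x hx)
  · exact ContinuousOn.intervalIntegrable (by rw [uIcc_of_le hab]; exact hf x₀ hx₀)
  · refine Filter.Eventually.of_forall fun t ht x hx => ?_
    rw [uIoc_of_le hab] at ht
    exact hC (x, t) ⟨Metric.ball_subset_closedBall hx, Ioc_subset_Icc_self ht⟩
  · exact intervalIntegrable_const
  · refine Filter.Eventually.of_forall fun t ht x hx => ?_
    rw [uIoc_of_le hab] at ht
    exact hd x (hball (Metric.ball_subset_closedBall hx)) t (Ioc_subset_Icc_self ht)

theorem hasDerivAt_integral_mul_comp_mul {w φ : ℝ → ℝ} (hw : Continuous w)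
    (hφ : ContDiff ℝ (⊤ : ℕ∞) φ) (x : ℝ) :
    HasDerivAt (fun x => ∫ t in (0 : ℝ)..1, w t * φ (t * x))
      (∫ t in (0 : ℝ)..1, (w t * t) * deriv φ (t * x)) x := by
  have hφc := hφ.continuous
  have hφ'c := hφ.continuous_deriv (by simp)
  refine hasDerivAt_intervalIntegral_of_continuousOn
    (f' := fun x t => (w t * t) * deriv φ (t * x)) zero_le_one Filter.univ_mem
    (fun x _ => by fun_prop) (by unfold Function.uncurry; fun_prop) fun x _ t _ => ?_
  have h1 : HasDerivAt (fun x => t * x) t x := by simpa using (hasDerivAt_id x).const_mul t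
  have h2 : HasDerivAt φ (deriv φ (t * x)) (t * x) :=
    ((hφ.differentiable (by simp)) _).hasDerivAt
  exact ((h2.comp x h1).const_mul (w t)).congr_deriv (by ring)

theorem contDiff_integral_mul_comp_mul (n : ℕ) : ∀ {w φ : ℝ → ℝ}, Continuous w →
    ContDiff ℝ (⊤ : ℕ∞) φ → ContDiff ℝ n (fun x => ∫ t in (0 : ℝ)..1, w t * φ (t * x)) := by
  induction n with
  | zero =>
    intro w φ hw hφ
    exact contDiff_zero.2 (continuous_iff_continuousAt.2 fun x =>
      (hasDerivAt_integral_mul_comp_mul hw hφ x).continuousAt)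
  | succ n ih =>
    intro w φ hw hφ
    rw [Nat.cast_succ, contDiff_succ_iff_deriv]
    refine ⟨fun x => (hasDerivAt_integral_mul_comp_mul hw hφ x).differentiableAt, by simp, ?_⟩
    rw [funext fun x => (hasDerivAt_integral_mul_comp_mul hw hφ x).deriv]
    exact ih (by fun_prop) ((contDiff_infty_iff_deriv.1 hφ).2)

/-- The **Hadamard lemma** on the real line. -/
theorem exists_contDiff_eq_mul {f : ℝ → ℝ} (hf : ContDiff ℝ (⊤ : ℕ∞) f) (h0 : f 0 = 0) :
    ∃ g : ℝ → ℝ, ContDiff ℝ (⊤ : ℕ∞) g ∧ ∀ x, f x = x * g x := by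
  have hf' := (contDiff_infty_iff_deriv.1 hf).2
  refine ⟨fun x => ∫ t in (0 : ℝ)..1, 1 * deriv f (t * x),
    contDiff_infty.2 fun n => contDiff_integral_mul_comp_mul n continuous_const hf', fun x => ?_⟩
  have hc := hf'.continuous
  have h : ∀ t ∈ uIcc (0 : ℝ) 1, HasDerivAt (fun t => f (t * x)) (x * (1 * deriv f (t * x))) t := by
    intro t _
    have h1 : HasDerivAt (fun t => t * x) x t := by simpa using (hasDerivAt_id t).mul_const x
    have h2 : HasDerivAt f (deriv f (t * x)) (t * x) :=
      ((hf.differentiable (by simp)) _).hasDerivAt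
    exact (h2.comp t h1).congr_deriv (by ring)
  have := intervalIntegral.integral_eq_sub_of_hasDerivAt h
    (Continuous.intervalIntegrable (by fun_prop) _ _)
  rw [intervalIntegral.integral_const_mul] at this
  simpa [h0] using this.symm

/-- A smooth function with a nondegenerate critical zero at `0`, and no other critical point on an
interval bounded by two points of a level set, is a square in a smooth coordinate there. -/
theorem exists_contDiffOn_inverse_sqrt {F : ℝ → ℝ} (hF : ContDiff ℝ (⊤ : ℕ∞) F)
    (hF0 : F 0 = 0) (hF'0 : deriv F 0 = 0) (hF''0 : 0 < deriv (deriv F) 0)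
    {R xm xp : ℝ} (hR : 0 < R) (hxm : xm < 0) (hxp : 0 < xp) (hFxm : F xm = R ^ 2)
    (hFxp : F xp = R ^ 2) (hpos : ∀ x ∈ Ioc 0 xp, 0 < deriv F x)
    (hneg : ∀ x ∈ Ico xm 0, deriv F x < 0) :
    ∃ a : ℝ → ℝ, ContDiffOn ℝ (⊤ : ℕ∞) a (Ioo (-R) R) ∧
      (∀ u ∈ Ioo (-R) R, a u ∈ Ioo xm xp) ∧ (∀ u ∈ Ioo (-R) R, F (a u) = u ^ 2) ∧
      (∀ u ∈ Ioo (-R) R, 0 < deriv a u) ∧ (∀ x ∈ Ioo xm xp, ∃ u ∈ Ioo (-R) R, a u = x) ∧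
      a 0 = 0 := by
  obtain ⟨g, hg, hFg⟩ := exists_contDiff_eq_mul hF hF0
  have hFd : ∀ x, deriv F x = g x + x * deriv g x := fun x => by
    rw [funext hFg]
    exact (((hasDerivAt_id x).mul ((hg.differentiable (by simp)) x).hasDerivAt).congr_deriv
      (by simp)).deriv
  obtain ⟨h, hh, hgh⟩ := exists_contDiff_eq_mul hg (by simpa [hFd] using hF'0)
  have hhd : ∀ x, HasDerivAt h (deriv h x) x := fun x =>
    ((hh.differentiable (by simp)) x).hasDerivAt
  have hFh : ∀ x, F x = x ^ 2 * h x := fun x => by rw [hFg, hgh]; ring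
  have hFd : ∀ x, deriv F x = x * (2 * h x + x * deriv h x) := fun x => by
    rw [funext hFh]
    exact (((hasDerivAt_pow 2 x).mul (hhd x)).congr_deriv (by simp; ring)).deriv
  have hh0 : 0 < h 0 := by
    have hh' := (contDiff_infty_iff_deriv.1 hh).2
    have h1 : HasDerivAt (fun x => 2 * h x + x * deriv h x)
        (2 * deriv h 0 + (1 * deriv h 0 + 0 * deriv (deriv h) 0)) 0 :=
      ((hhd 0).const_mul 2).add
        ((hasDerivAt_id 0).mul ((hh'.differentiable (by simp)) 0).hasDerivAt)
    have h2 := ((hasDerivAt_id (0 : ℝ)).mul h1).deriv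
    have h3 : deriv F = fun x => x * (2 * h x + x * deriv h x) := funext hFd
    rw [h3] at hF''0
    have h4 : deriv (fun x => x * (2 * h x + x * deriv h x)) 0 = 2 * h 0 := by
      refine Eq.trans h2 ?_
      simp
    linarith
  have hFc := hF.continuous
  have hFpos : ∀ x ∈ Icc xm xp, x ≠ 0 → 0 < F x := by
    intro x hx hx0
    rcases lt_or_gt_of_ne hx0 with hlt | hgt
    · have := strictAntiOn_of_deriv_neg (convex_Icc xm 0) hFc.continuousOn
        (fun y hy => hneg y (by rw [interior_Icc] at hy; exact ⟨hy.1.le, hy.2⟩))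
      simpa [hF0] using this ⟨hx.1, hlt.le⟩ ⟨hxm.le, le_rfl⟩ hlt
    · have := strictMonoOn_of_deriv_pos (convex_Icc 0 xp) hFc.continuousOn
        (fun y hy => hpos y (by rw [interior_Icc] at hy; exact ⟨hy.1, hy.2.le⟩))
      simpa [hF0] using this ⟨le_rfl, hxp.le⟩ ⟨hgt.le, hx.2⟩ hgt
  have hhpos : ∀ x ∈ Icc xm xp, 0 < h x := by
    intro x hx
    rcases eq_or_ne x 0 with rfl | hx0
    · exact hh0
    · have := hFpos x hx hx0
      rw [hFh] at this
      exact pos_of_mul_pos_right this (sq_nonneg x)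
  have hdpos : ∀ x ∈ Icc xm xp, 0 < 2 * h x + x * deriv h x := by
    intro x hx
    rcases lt_trichotomy x 0 with hlt | rfl | hgt
    · have := hneg x ⟨hx.1, hlt⟩
      rw [hFd] at this
      exact pos_of_mul_neg_right this hlt.le
    · simpa using hh0
    · have := hpos x ⟨hgt, hx.2⟩
      rw [hFd] at this
      exact pos_of_mul_pos_right this hgt.le
  set U : ℝ → ℝ := fun x => x * √(h x) with hU
  have hUd : ∀ x ∈ Icc xm xp, HasDerivAt U ((2 * h x + x * deriv h x) / (2 * √(h x))) x := by
    intro x hx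
    have h1 := hhpos x hx
    have h2 := Real.sqrt_pos.2 h1
    refine ((hasDerivAt_id x).mul ((hhd x).sqrt h1.ne')).congr_deriv ?_
    have := Real.sq_sqrt h1.le
    simp only [id]
    field_simp
    rw [this]
    ring
  have hUd' : ∀ x ∈ Icc xm xp, 0 < deriv U x := fun x hx => by
    rw [(hUd x hx).deriv]
    have := Real.sqrt_pos.2 (hhpos x hx)
    have := hdpos x hx
    positivity
  have hUsmooth : ∀ x ∈ Icc xm xp, ContDiffAt ℝ (⊤ : ℕ∞) U x := fun x hx =>
    contDiffAt_id.mul (hh.contDiffAt.sqrt (hhpos x hx).ne')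
  have hUc : ContinuousOn U (Icc xm xp) := fun x hx => (hUsmooth x hx).continuousAt.continuousWithinAt
  have hUmono : StrictMonoOn U (Icc xm xp) :=
    strictMonoOn_of_deriv_pos (convex_Icc _ _) hUc fun x hx =>
      hUd' x (interior_subset hx)
  have hUsq : ∀ x ∈ Icc xm xp, U x ^ 2 = F x := fun x hx => by
    rw [hU, mul_pow, Real.sq_sqrt (hhpos x hx).le, hFh]
  have hxmp : xm ≤ xp := (hxm.trans hxp).le
  have hUxm : U xm = -R := by
    have h1 := hUsq xm ⟨le_rfl, hxmp⟩
    have h2 : U xm < 0 := mul_neg_of_neg_of_pos hxm (Real.sqrt_pos.2 (hhpos xm ⟨le_rfl, hxmp⟩))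
    rw [hFxm, sq_eq_sq_iff_eq_or_eq_neg] at h1
    rcases h1 with h1 | h1
    · linarith
    · exact h1
  have hUxp : U xp = R := by
    have h1 := hUsq xp ⟨hxmp, le_rfl⟩
    have h2 : 0 < U xp := mul_pos hxp (Real.sqrt_pos.2 (hhpos xp ⟨hxmp, le_rfl⟩))
    rw [hFxp, sq_eq_sq_iff_eq_or_eq_neg] at h1
    rcases h1 with h1 | h1
    · exact h1
    · linarith
  have hUmaps : ∀ x ∈ Ioo xm xp, U x ∈ Ioo (-R) R := fun x hx => by
    rw [← hUxm, ← hUxp]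
    exact ⟨hUmono ⟨le_rfl, hxmp⟩ (Ioo_subset_Icc_self hx) hx.1,
      hUmono (Ioo_subset_Icc_self hx) ⟨hxmp, le_rfl⟩ hx.2⟩
  have hUsurj : SurjOn U (Ioo xm xp) (Ioo (-R) R) := by
    have := intermediate_value_Ioo hxmp hUc
    rwa [hUxm, hUxp] at this
  have hUinj : InjOn U (Ioo xm xp) := (hUmono.mono Ioo_subset_Icc_self).injOn
  set a : ℝ → ℝ := Function.invFunOn U (Ioo xm xp) with ha
  have hamaps : ∀ u ∈ Ioo (-R) R, a u ∈ Ioo xm xp := fun u hu => hUsurj.mapsTo_invFunOn hu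
  have hUa : ∀ u ∈ Ioo (-R) R, U (a u) = u := fun u hu => hUsurj.rightInvOn_invFunOn hu
  have haU : ∀ x ∈ Ioo xm xp, a (U x) = x := fun x hx => hUinj.leftInvOn_invFunOn hx
  have hamono : StrictMonoOn a (Ioo (-R) R) := fun u hu v hv huv => by
    rw [← hUmono.lt_iff_lt (Ioo_subset_Icc_self (hamaps u hu))
      (Ioo_subset_Icc_self (hamaps v hv)), hUa u hu, hUa v hv]
    exact huv
  have hac : ContinuousOn a (Ioo (-R) R) := by
    intro u hu
    refine (hamono.continuousAt_of_image_mem_nhds (isOpen_Ioo.mem_nhds hu) ?_).continuousWithinAt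
    refine Filter.mem_of_superset (isOpen_Ioo.mem_nhds (hamaps u hu)) fun x hx => ?_
    exact ⟨U x, hUmaps x hx, haU x hx⟩
  let e : OpenPartialHomeomorph ℝ ℝ :=
    { toFun := U
      invFun := a
      source := Ioo xm xp
      target := Ioo (-R) R
      map_source' := hUmaps
      map_target' := hamaps
      left_inv' := haU
      right_inv' := hUa
      open_source := isOpen_Ioo
      open_target := isOpen_Ioo
      continuousOn_toFun := hUc.mono Ioo_subset_Icc_self
      continuousOn_invFun := hac }
  have hasmooth : ∀ u ∈ Ioo (-R) R, ContDiffAt ℝ (⊤ : ℕ∞) a u := fun u hu => by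
    have hau := Ioo_subset_Icc_self (hamaps u hu)
    exact e.contDiffAt_symm_deriv (hUd' _ hau).ne' hu
      ((hUsmooth _ hau).differentiableAt (by simp)).hasDerivAt (hUsmooth _ hau)
  refine ⟨a, fun u hu => (hasmooth u hu).contDiffWithinAt, hamaps, fun u hu => ?_, fun u hu => ?_,
    fun x hx => ⟨U x, hUmaps x hx, haU x hx⟩, ?_⟩
  · rw [← hUsq _ (Ioo_subset_Icc_self (hamaps u hu)), hUa u hu]
  · have hau := Ioo_subset_Icc_self (hamaps u hu)
    have h1 := ((hUsmooth _ hau).differentiableAt (by simp)).hasDerivAt.comp u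
      ((hasmooth u hu).differentiableAt (by simp)).hasDerivAt
    have h2 : HasDerivAt (U ∘ a) 1 u := (hasDerivAt_id u).congr_of_eventuallyEq <| by
      filter_upwards [isOpen_Ioo.mem_nhds hu] with v hv using hUa v hv
    have h3 := h1.unique h2
    exact pos_of_mul_pos_right (by rw [h3]; exact one_pos) (hUd' _ hau).le
  · have := haU 0 ⟨hxm, hxp⟩
    simpa [hU] using this

theorem deriv_comp_mul_deriv_of_eqOn {f a g : ℝ → ℝ} {I : Set ℝ} (hI : IsOpen I)
    (hf : Differentiable ℝ f) (ha : DifferentiableOn ℝ a I) (h : ∀ u ∈ I, f (a u) = g u)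
    {u g' : ℝ} (hu : u ∈ I) (hg : HasDerivAt g g' u) : deriv f (a u) * deriv a u = g' :=
  ((hf _).hasDerivAt.comp u (ha.differentiableAt (hI.mem_nhds hu)).hasDerivAt).unique
    (hg.congr_of_eventuallyEq (by filter_upwards [hI.mem_nhds hu] with v hv using h v hv))

/-- `M` in the coordinates in which `F` and `G` are squares. -/
theorem Mfun_comp_eq {F G a b : ℝ → ℝ} {R u v : ℝ}
    (hF : ContDiff ℝ (⊤ : ℕ∞) F) (hG : ContDiff ℝ (⊤ : ℕ∞) G)
    (ha : ContDiffOn ℝ (⊤ : ℕ∞) a (Ioo (-R) R)) (hb : ContDiffOn ℝ (⊤ : ℕ∞) b (Ioo (-R) R))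
    (hFa : ∀ u ∈ Ioo (-R) R, F (a u) = u ^ 2) (hGb : ∀ u ∈ Ioo (-R) R, G (b u) = u ^ 2)
    (ha' : ∀ u ∈ Ioo (-R) R, 0 < deriv a u) (hb' : ∀ u ∈ Ioo (-R) R, 0 < deriv b u)
    (hu : u ∈ Ioo (-R) R) (hv : v ∈ Ioo (-R) R) :
    Mfun F G (a u) (b v) = 32 * u ^ 4 * v ^ 3 / (deriv a u ^ 5 * deriv b v ^ 3) *
      (v * deriv (deriv (deriv a)) u * deriv b v +
        (deriv a u - u * deriv (deriv a) u) * deriv (deriv b) v) := by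
  have hI : IsOpen (Ioo (-R) R) := isOpen_Ioo
  have hda := ha.differentiableOn (by simp)
  have hdb := hb.differentiableOn (by simp)
  have hp := ha.deriv_of_isOpen (m := (⊤ : ℕ∞)) hI (by simp)
  have hq := hb.deriv_of_isOpen (m := (⊤ : ℕ∞)) hI (by simp)
  have hp1 := hp.deriv_of_isOpen (m := (⊤ : ℕ∞)) hI (by simp)
  have hder : ∀ {f : ℝ → ℝ}, ContDiffOn ℝ (⊤ : ℕ∞) f (Ioo (-R) R) → ∀ {w}, w ∈ Ioo (-R) R →
      HasDerivAt f (deriv f w) w := fun hf _ hw =>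
    ((hf.differentiableOn (by simp)).differentiableAt (hI.mem_nhds hw)).hasDerivAt
  have hF' := (contDiff_infty_iff_deriv.1 hF).2
  have hF'' := (contDiff_infty_iff_deriv.1 hF').2
  have hG' := (contDiff_infty_iff_deriv.1 hG).2
  have first : ∀ {H c : ℝ → ℝ}, ContDiff ℝ (⊤ : ℕ∞) H → ContDiffOn ℝ (⊤ : ℕ∞) c (Ioo (-R) R) →
      (∀ u ∈ Ioo (-R) R, H (c u) = u ^ 2) → (∀ u ∈ Ioo (-R) R, 0 < deriv c u) →
      ∀ u ∈ Ioo (-R) R, deriv H (c u) = 2 * u / deriv c u := by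
    intro H c hH hc hHc hc' u hu
    rw [eq_div_iff (hc' u hu).ne', deriv_comp_mul_deriv_of_eqOn hI (hH.differentiable (by simp))
      (hc.differentiableOn (by simp)) hHc hu (hasDerivAt_pow 2 u)]
    simp
  have second : ∀ {H c : ℝ → ℝ}, ContDiff ℝ (⊤ : ℕ∞) H → ContDiffOn ℝ (⊤ : ℕ∞) c (Ioo (-R) R) →
      (∀ u ∈ Ioo (-R) R, H (c u) = u ^ 2) → (∀ u ∈ Ioo (-R) R, 0 < deriv c u) →
      ∀ u ∈ Ioo (-R) R, deriv (deriv H) (c u) =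
        2 / deriv c u ^ 2 - 2 * u * deriv (deriv c) u / deriv c u ^ 3 := by
    intro H c hH hc hHc hc' u hu
    have hp := hc.deriv_of_isOpen (m := (⊤ : ℕ∞)) hI (by simp)
    have hpos := (hc' u hu).ne'
    have := deriv_comp_mul_deriv_of_eqOn hI
      ((contDiff_infty_iff_deriv.1 hH).2.differentiable (by simp)) (hc.differentiableOn (by simp))
      (first hH hc hHc hc') hu (((hasDerivAt_id u).const_mul 2).div (hder hp hu) hpos)
    rw [← eq_div_iff hpos] at this
    rw [this]
    simp only [id]
    field_simp
  have third : deriv (deriv (deriv F)) (a u) = -6 * deriv (deriv a) u / deriv a u ^ 4 -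
      2 * u * deriv (deriv (deriv a)) u / deriv a u ^ 4 +
      6 * u * deriv (deriv a) u ^ 2 / deriv a u ^ 5 := by
    have hpos := (ha' u hu).ne'
    have h1 := hder hp hu
    have h2 := hder hp1 hu
    have := deriv_comp_mul_deriv_of_eqOn hI (hF''.differentiable (by simp)) hda
      (second hF ha hFa ha') hu
      (((hasDerivAt_const u (2 : ℝ)).div (h1.pow 2) (pow_ne_zero 2 hpos)).sub
        ((((hasDerivAt_id u).const_mul 2).mul h2).div (h1.pow 3) (pow_ne_zero 3 hpos)))
    rw [← eq_div_iff hpos] at this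
    rw [this]
    simp only [id, Pi.pow_apply, Pi.mul_apply]
    field_simp
    ring
  have hpos := (ha' u hu).ne'
  have hqpos := (hb' v hv).ne'
  rw [Mfun, third, second hF ha hFa ha' u hu, second hG hb hGb hb' v hv, first hF ha hFa ha' u hu,
    first hG hb hGb hb' v hv, hFa u hu, hGb v hv]
  field_simp
  ring

open Real in
/-- The derivative of the period integral in polar coordinates, after an integration by parts. -/
theorem hasDerivAt_integral_sin_cos {p q : ℝ → ℝ} {R r : ℝ}
    (hp : ContDiffOn ℝ (⊤ : ℕ∞) p (Ioo (-R) R)) (hq : ContDiffOn ℝ (⊤ : ℕ∞) q (Ioo (-R) R))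
    (hr : r ∈ Ioo (-R) R) :
    HasDerivAt (fun r => ∫ θ in (-(π / 2))..(π / 2), p (r * sin θ) * q (r * cos θ))
      (∫ θ in (-(π / 2))..(π / 2), cos θ *
        (r * cos θ * deriv (deriv p) (r * sin θ) * q (r * cos θ) +
          (p (r * sin θ) - r * sin θ * deriv p (r * sin θ)) * deriv q (r * cos θ))) r := by
  have hI : IsOpen (Ioo (-R) R) := isOpen_Ioo
  have hp1 := hp.deriv_of_isOpen (m := (⊤ : ℕ∞)) hI (by simp)
  have hp2 := (hp1.deriv_of_isOpen (m := (⊤ : ℕ∞)) hI (by simp)).continuousOn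
  have hq1 := (hq.deriv_of_isOpen (m := (⊤ : ℕ∞)) hI (by simp)).continuousOn
  have hder : ∀ {f : ℝ → ℝ}, ContDiffOn ℝ (⊤ : ℕ∞) f (Ioo (-R) R) → ∀ {w}, w ∈ Ioo (-R) R →
      HasDerivAt f (deriv f w) w := fun hf _ hw =>
    ((hf.differentiableOn (by simp)).differentiableAt (hI.mem_nhds hw)).hasDerivAt
  have hmem : ∀ {r c : ℝ}, r ∈ Ioo (-R) R → |c| ≤ 1 → r * c ∈ Ioo (-R) R := fun {r c} hr hc => by
    rw [mem_Ioo, ← abs_lt] at hr ⊢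
    rw [abs_mul]
    exact (mul_le_of_le_one_right (abs_nonneg r) hc).trans_lt hr
  have hs : ∀ {r}, r ∈ Ioo (-R) R → ∀ θ, r * sin θ ∈ Ioo (-R) R :=
    fun hr θ => hmem hr (abs_sin_le_one θ)
  have hc : ∀ {r}, r ∈ Ioo (-R) R → ∀ θ, r * cos θ ∈ Ioo (-R) R :=
    fun hr θ => hmem hr (abs_cos_le_one θ)
  have hcs : ∀ {f : ℝ → ℝ}, ContinuousOn f (Ioo (-R) R) →
      ContinuousOn (fun z : ℝ × ℝ => f (z.1 * sin z.2)) (Ioo (-R) R ×ˢ univ) := fun hf =>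
    hf.comp (by fun_prop) fun z hz => hs hz.1 z.2
  have hcc : ∀ {f : ℝ → ℝ}, ContinuousOn f (Ioo (-R) R) →
      ContinuousOn (fun z : ℝ × ℝ => f (z.1 * cos z.2)) (Ioo (-R) R ×ˢ univ) := fun hf =>
    hf.comp (by fun_prop) fun z hz => hc hz.1 z.2
  have hfix : ∀ {f : ℝ × ℝ → ℝ}, ContinuousOn f (Ioo (-R) R ×ˢ univ) →
      ∀ {r}, r ∈ Ioo (-R) R → Continuous (fun θ => f (r, θ)) := fun {f} hf {r} hr => by
    rw [← continuousOn_univ]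
    exact hf.comp (f := fun θ => (r, θ)) (by fun_prop) fun θ _ => ⟨hr, mem_univ θ⟩
  have h1 := hasDerivAt_intervalIntegral_of_continuousOn (a := -(π / 2)) (b := π / 2)
    (f := fun r θ => p (r * sin θ) * q (r * cos θ))
    (f' := fun r θ => sin θ * deriv p (r * sin θ) * q (r * cos θ) +
      p (r * sin θ) * (cos θ * deriv q (r * cos θ))) (by linarith [pi_pos]) (hI.mem_nhds hr)
    (fun x hx => (hfix ((hcs hp.continuousOn).mul (hcc hq.continuousOn)) hx).continuousOn)
    (by
      refine ContinuousOn.mono ?_ (prod_mono le_rfl (subset_univ _))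
      exact (((by fun_prop : Continuous fun z : ℝ × ℝ => sin z.2).continuousOn.mul
        (hcs hp1.continuousOn)).mul (hcc hq.continuousOn)).add ((hcs hp.continuousOn).mul
        ((by fun_prop : Continuous fun z : ℝ × ℝ => cos z.2).continuousOn.mul (hcc hq1))))
    (fun x hx θ _ => by
      have e1 : HasDerivAt (fun x => x * sin θ) (sin θ) x := by
        simpa using (hasDerivAt_id x).mul_const (sin θ)
      have e2 : HasDerivAt (fun x => x * cos θ) (cos θ) x := by
        simpa using (hasDerivAt_id x).mul_const (cos θ)
      exact (((hder hp (hs hx θ)).comp x e1).mul ((hder hq (hc hx θ)).comp x e2)).congr_deriv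
        (by simp only [Function.comp]; ring))
  refine h1.congr_deriv ?_
  have cp := hfix (hcs hp.continuousOn) hr
  have cp1 := hfix (hcs hp1.continuousOn) hr
  have cp2 := hfix (hcs hp2) hr
  have cq := hfix (hcc hq.continuousOn) hr
  have cq1 := hfix (hcc hq1) hr
  simp only at cp cp1 cp2 cq cq1
  have h2 : ∀ θ ∈ uIcc (-(π / 2)) (π / 2), HasDerivAt
      (fun θ => cos θ * (deriv p (r * sin θ) * q (r * cos θ)))
      (cos θ * (r * cos θ * deriv (deriv p) (r * sin θ) * q (r * cos θ) +
          (p (r * sin θ) - r * sin θ * deriv p (r * sin θ)) * deriv q (r * cos θ)) -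
        (sin θ * deriv p (r * sin θ) * q (r * cos θ) +
          p (r * sin θ) * (cos θ * deriv q (r * cos θ)))) θ := by
    intro θ _
    have e1 := (hasDerivAt_sin θ).const_mul r
    have e2 := (hasDerivAt_cos θ).const_mul r
    refine ((hasDerivAt_cos θ).mul (((hder hp1 (hs hr θ)).comp θ e1).mul
      ((hder hq (hc hr θ)).comp θ e2))).congr_deriv ?_
    simp only [Function.comp, Pi.mul_apply]
    ring
  have c1 := continuous_cos.mul (((((continuous_const (y := r)).mul continuous_cos).mul cp2).mul
    cq).add ((cp.sub (((continuous_const (y := r)).mul continuous_sin).mul cp1)).mul cq1))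
  have c2 := ((continuous_sin.mul cp1).mul cq).add (cp.mul (continuous_cos.mul cq1))
  have h3 := intervalIntegral.integral_eq_sub_of_hasDerivAt h2
    ((c1.sub c2).intervalIntegrable _ _)
  have h4 := intervalIntegral.integral_sub (μ := MeasureTheory.volume)
    (c1.intervalIntegrable (-(π / 2)) (π / 2)) (c2.intervalIntegrable _ _)
  exact (sub_eq_zero.1 (h4.symm.trans (h3.trans (by simp)))).symm

open Real MeasureTheory in
/-- The period integral in polar coordinates. -/
theorem integral_Ioo_comp_sin {a : ℝ → ℝ} {R r : ℝ} (ha : ContDiffOn ℝ (⊤ : ℕ∞) a (Ioo (-R) R))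
    (ha' : ∀ u ∈ Ioo (-R) R, 0 < deriv a u) (hr : r ∈ Ioo 0 R) (g : ℝ → ℝ) :
    ∫ x in Ioo (a (-r)) (a r), g x =
      ∫ θ in Ioo (-(π / 2)) (π / 2), deriv a (r * sin θ) * (r * cos θ) * g (a (r * sin θ)) := by
  have hda := ha.differentiableOn (by simp)
  have hmono : StrictMonoOn a (Ioo (-R) R) :=
    strictMonoOn_of_deriv_pos (convex_Ioo _ _) ha.continuousOn (by simpa using ha')
  have hsin : ∀ θ ∈ Ioo (-(π / 2)) (π / 2), r * sin θ ∈ Ioo (-r) r := fun θ hθ => by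
    have h1 := strictMonoOn_sin ⟨le_rfl, by linarith [pi_pos]⟩ (Ioo_subset_Icc_self hθ) hθ.1
    have h2 := strictMonoOn_sin (Ioo_subset_Icc_self hθ) ⟨by linarith [pi_pos], le_rfl⟩ hθ.2
    rw [sin_neg, sin_pi_div_two] at h1
    rw [sin_pi_div_two] at h2
    constructor <;> nlinarith [hr.1]
  have hsub : Icc (-r) r ⊆ Ioo (-R) R := Icc_subset_Ioo (by linarith [hr.2]) hr.2
  have hr' : -r ≤ r := by linarith [hr.1]
  have himage : (fun θ => a (r * sin θ)) '' Ioo (-(π / 2)) (π / 2) = Ioo (a (-r)) (a r) := by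
    refine Subset.antisymm (image_subset_iff.2 fun θ hθ => ?_) fun x hx => ?_
    · have h := hsin θ hθ
      have h' := hsub (Ioo_subset_Icc_self h)
      exact ⟨hmono (hsub ⟨le_rfl, hr'⟩) h' h.1, hmono h' (hsub ⟨hr', le_rfl⟩) h.2⟩
    · obtain ⟨u, hu, rfl⟩ := intermediate_value_Ioo hr' (ha.continuousOn.mono hsub) hx
      have h1 : -1 < u / r := by rw [lt_div_iff₀ hr.1]; linarith [hu.1]
      have h2 : u / r < 1 := by rw [div_lt_iff₀ hr.1]; linarith [hu.2]
      refine ⟨arcsin (u / r), ⟨neg_pi_div_two_lt_arcsin.2 h1, arcsin_lt_pi_div_two.2 h2⟩, ?_⟩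
      simp only
      rw [sin_arcsin h1.le h2.le, mul_div_cancel₀ _ hr.1.ne']
  have hinj : InjOn (fun θ => a (r * sin θ)) (Ioo (-(π / 2)) (π / 2)) := by
    intro s hs t ht hst
    have h1 := hmono.injOn (hsub (Ioo_subset_Icc_self (hsin s hs)))
      (hsub (Ioo_subset_Icc_self (hsin t ht))) hst
    exact injOn_sin (Ioo_subset_Icc_self hs) (Ioo_subset_Icc_self ht)
      (mul_left_cancel₀ hr.1.ne' h1)
  rw [← himage, integral_image_eq_integral_abs_deriv_smul measurableSet_Ioo
    (f' := fun θ => deriv a (r * sin θ) * (r * cos θ)) (fun θ hθ => ?_) hinj]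
  · refine setIntegral_congr_fun measurableSet_Ioo fun θ hθ => ?_
    have h1 := ha' _ (hsub (Ioo_subset_Icc_self (hsin θ hθ)))
    have h2 := cos_pos_of_mem_Ioo hθ
    have h3 := hr.1
    simp only [smul_eq_mul]
    rw [abs_of_pos (by positivity)]
  · exact ((hda.differentiableAt (isOpen_Ioo.mem_nhds
      (hsub (Ioo_subset_Icc_self (hsin θ hθ))))).hasDerivAt.comp θ
        ((hasDerivAt_sin θ).const_mul r)).hasDerivWithinAt

open Real MeasureTheory in
theorem stmt0
    (F G : ℝ → ℝ)
    (hF : ContDiff ℝ (⊤ : ℕ∞) F) (hG : ContDiff ℝ (⊤ : ℕ∞) G)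
    (hGeven : ∀ y, G (-y) = G y)
    (hF0 : F 0 = 0) (hG0 : G 0 = 0)
    (hF'0 : deriv F 0 = 0) (hG'0 : deriv G 0 = 0)
    (hF''0 : 0 < deriv (deriv F) 0) (hG''0 : 0 < deriv (deriv G) 0)
    (E₀ : ℝ) (hE₀ : 0 < E₀)
    (xm xp : ℝ) (hxm : xm < 0) (hxp : 0 < xp)
    (hFxm : F xm = E₀) (hFxp : F xp = E₀)
    (hF'pos : ∀ x ∈ Ioc 0 xp, 0 < deriv F x)
    (hF'neg : ∀ x ∈ Ico xm 0, deriv F x < 0)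
    (y₀ : ℝ) (hy₀ : 0 < y₀) (hGy₀ : G y₀ = E₀)
    (hG'pos : ∀ y ∈ Ioc 0 y₀, 0 < deriv G y)
    (xmE xpE : ℝ → ℝ)
    (hxmE : ∀ E ∈ Ioo 0 E₀, xmE E ∈ Ioo xm 0 ∧ F (xmE E) = E)
    (hxpE : ∀ E ∈ Ioo 0 E₀, xpE E ∈ Ioo 0 xp ∧ F (xpE E) = E)
    (Φ : ℝ → ℝ)
    (hΦmaps : ∀ E ∈ Icc 0 E₀, Φ E ∈ Icc 0 y₀)
    (hΦinv : ∀ E ∈ Icc 0 E₀, G (Φ E) = E)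
    (hΦinv' : ∀ y ∈ Icc 0 y₀, Φ (G y) = y)
    (T : ℝ → ℝ)
    (hT : ∀ E ∈ Ioo 0 E₀,
      T E = 2 * ∫ x in (xmE E)..(xpE E), 1 / deriv G (Φ (E - F x))) :
    ((∀ x y, x ∈ Icc xm xp → |y| ≤ y₀ → F x + G y ≤ E₀ → 0 ≤ Mfun F G x y) →
      ∀ E₁ E₂, 0 < E₁ → E₁ ≤ E₂ → E₂ < E₀ → T E₁ ≤ T E₂) ∧
    ((∀ x y, x ∈ Icc xm xp → |y| ≤ y₀ → F x + G y ≤ E₀ → Mfun F G x y ≤ 0) →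
      ∀ E₁ E₂, 0 < E₁ → E₁ ≤ E₂ → E₂ < E₀ → T E₂ ≤ T E₁) := by
  obtain ⟨R, hR, hRE⟩ : ∃ R, 0 < R ∧ R ^ 2 = E₀ := ⟨√E₀, Real.sqrt_pos.2 hE₀, Real.sq_sqrt hE₀.le⟩
  have hG'neg : ∀ y ∈ Ico (-y₀) 0, deriv G y < 0 := fun y hy => by
    have h1 := hG'pos (-y) ⟨by linarith [hy.2], by linarith [hy.1]⟩
    have h2 : deriv G y = -deriv G (-y) := by
      rw [← deriv_comp_neg, funext hGeven]
    linarith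
  obtain ⟨a, ha, hamaps, hFa, ha', hasurj, ha0⟩ := exists_contDiffOn_inverse_sqrt hF hF0 hF'0 hF''0
    hR hxm hxp (hFxm.trans hRE.symm) (hFxp.trans hRE.symm) hF'pos hF'neg
  obtain ⟨b, hb, hbmaps, hGb, hb', -, hb0⟩ := exists_contDiffOn_inverse_sqrt hG hG0 hG'0 hG''0
    hR (neg_lt_zero.2 hy₀) hy₀ (((hGeven y₀).trans hGy₀).trans hRE.symm) (hGy₀.trans hRE.symm)
    hG'pos hG'neg
  have hI : IsOpen (Ioo (-R) R) := isOpen_Ioo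
  have hamono : StrictMonoOn a (Ioo (-R) R) :=
    strictMonoOn_of_deriv_pos (convex_Ioo _ _) ha.continuousOn (by simpa using ha')
  have hbmono : StrictMonoOn b (Ioo (-R) R) :=
    strictMonoOn_of_deriv_pos (convex_Ioo _ _) hb.continuousOn (by simpa using hb')
  have h0R : (0 : ℝ) ∈ Ioo (-R) R := ⟨by linarith, hR⟩
  have hlevel : ∀ {r u x}, r ∈ Ioo 0 R → u ∈ Ioo (-R) R → a u = x → F x = r ^ 2 →
      u = r ∨ u = -r := by
    rintro r u x hr hu rfl hx
    rwa [hFa u hu, sq_eq_sq_iff_eq_or_eq_neg] at hx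
  have hrE : ∀ {r}, r ∈ Ioo 0 R → r ^ 2 ∈ Ioo 0 E₀ := fun hr => by
    rw [← hRE]
    exact ⟨pow_pos hr.1 2, pow_lt_pow_left₀ hr.2 hr.1.le two_ne_zero⟩
  have hap : ∀ {r}, r ∈ Ioo 0 R → xpE (r ^ 2) = a r := fun {r} hr => by
    obtain ⟨h1, h2⟩ := hxpE _ (hrE hr)
    obtain ⟨u, hu, hux⟩ := hasurj _ ⟨hxm.trans h1.1, h1.2⟩
    have hpos : 0 < u := by
      rw [← hamono.lt_iff_lt h0R hu, ha0, hux]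
      exact h1.1
    rcases hlevel hr hu hux h2 with rfl | rfl
    · exact hux.symm
    · linarith [hr.1]
  have ham : ∀ {r}, r ∈ Ioo 0 R → xmE (r ^ 2) = a (-r) := fun {r} hr => by
    obtain ⟨h1, h2⟩ := hxmE _ (hrE hr)
    obtain ⟨u, hu, hux⟩ := hasurj _ ⟨h1.1, h1.2.trans hxp⟩
    have hneg : u < 0 := by
      rw [← hamono.lt_iff_lt hu h0R, ha0, hux]
      exact h1.2
    rcases hlevel hr hu hux h2 with rfl | rfl
    · linarith [hr.1]
    · exact hux.symm
  set S : ℝ → ℝ := fun r =>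
    ∫ θ in (-(π / 2))..(π / 2), deriv a (r * sin θ) * deriv b (r * cos θ) with hS
  have hpi : -(π / 2) ≤ π / 2 := by linarith [pi_pos]
  have hsR : ∀ {r}, r ∈ Ioo 0 R → ∀ θ, r * sin θ ∈ Ioo (-R) R := fun {r} hr θ => by
    constructor <;> nlinarith [hr.1, hr.2, neg_one_le_sin θ, sin_le_one θ]
  have hcR : ∀ {r}, r ∈ Ioo 0 R → ∀ θ ∈ Ioo (-(π / 2)) (π / 2),
      r * cos θ ∈ Ioo (-R) R ∧ 0 < r * cos θ := fun {r} hr θ hθ => by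
    have h1 := mul_pos hr.1 (cos_pos_of_mem_Ioo hθ)
    exact ⟨⟨by linarith, by nlinarith [hr.1, hr.2, cos_le_one θ]⟩, h1⟩
  have hTS : ∀ {r}, r ∈ Ioo 0 R → T (r ^ 2) = S r := fun {r} hr => by
    have hr1 : r ∈ Ioo (-R) R := ⟨by linarith [hr.1], hr.2⟩
    have hr2 : -r ∈ Ioo (-R) R := ⟨by linarith [hr.2], by linarith [hr.1]⟩
    have hle : a (-r) ≤ a r := (hamono hr2 hr1 (by linarith [hr.1])).le
    rw [hT _ (hrE hr), hap hr, ham hr, intervalIntegral.integral_of_le hle,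
      integral_Ioc_eq_integral_Ioo, integral_Ioo_comp_sin ha ha' hr, ← integral_const_mul]
    simp only [hS]
    rw [intervalIntegral.integral_of_le hpi, integral_Ioc_eq_integral_Ioo]
    refine setIntegral_congr_fun measurableSet_Ioo fun θ hθ => ?_
    obtain ⟨h1, h2⟩ := hcR hr θ hθ
    have hbpos : 0 < b (r * cos θ) := by
      rw [← hb0]
      exact hbmono h0R h1 h2
    have h3 : r ^ 2 - F (a (r * sin θ)) = G (b (r * cos θ)) := by
      rw [hFa _ (hsR hr θ), hGb _ h1]
      linear_combination -(r ^ 2) * sin_sq_add_cos_sq θ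
    have h4 := deriv_comp_mul_deriv_of_eqOn hI (hG.differentiable (by simp))
      (hb.differentiableOn (by simp)) hGb h1 (hasDerivAt_pow 2 _)
    have h5 := hb' _ h1
    have h6 : deriv G (b (r * cos θ)) = 2 * (r * cos θ) / deriv b (r * cos θ) := by
      rw [eq_div_iff h5.ne', h4]
      simp
    rw [h3, hΦinv' _ ⟨hbpos.le, (hbmaps _ h1).2.le⟩, h6, one_div_div]
    have h7 : cos θ ≠ 0 := (cos_pos_of_mem_Ioo hθ).ne'
    have h8 := hr.1.ne'
    field_simp
  have hSd : ∀ r ∈ Ioo 0 R, HasDerivAt S _ r := fun r hr =>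
    hasDerivAt_integral_sin_cos (ha.deriv_of_isOpen (m := (⊤ : ℕ∞)) hI (by simp))
      (hb.deriv_of_isOpen (m := (⊤ : ℕ∞)) hI (by simp)) ⟨by linarith [hr.1], hr.2⟩
  have hSc : ContinuousOn S (Ioo 0 R) := fun r hr => (hSd r hr).continuousAt.continuousWithinAt
  have hM : ∀ {r}, r ∈ Ioo 0 R → ∀ θ ∈ Ioo (-(π / 2)) (π / 2), θ ≠ 0 → ∃ c > 0, ∃ x ∈ Icc xm xp,
      ∃ y, |y| ≤ y₀ ∧ F x + G y ≤ E₀ ∧ Mfun F G x y = c * (cos θ *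
        (r * cos θ * deriv (deriv (deriv a)) (r * sin θ) * deriv b (r * cos θ) +
          (deriv a (r * sin θ) - r * sin θ * deriv (deriv a) (r * sin θ)) *
            deriv (deriv b) (r * cos θ))) := fun {r} hr θ hθ hθ0 => by
    obtain ⟨h1, h2⟩ := hcR hr θ hθ
    have h3 := hsR hr θ
    have h4 := ha' _ h3
    have h5 := hb' _ h1
    have h6 := cos_pos_of_mem_Ioo hθ
    have h7 : sin θ ≠ 0 := fun h => hθ0 <|
      injOn_sin (Ioo_subset_Icc_self hθ) ⟨by linarith [pi_pos], by linarith [pi_pos]⟩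
        (h.trans sin_zero.symm)
    have h8 : 0 < (r * sin θ) ^ 4 := by
      have := mul_ne_zero hr.1.ne' h7
      positivity
    refine ⟨32 * (r * sin θ) ^ 4 * (r * cos θ) ^ 3 /
      (deriv a (r * sin θ) ^ 5 * deriv b (r * cos θ) ^ 3) / cos θ, by positivity, a (r * sin θ),
      Ioo_subset_Icc_self (hamaps _ h3), b (r * cos θ), ?_, ?_, ?_⟩
    · exact abs_le.2 ⟨(hbmaps _ h1).1.le, (hbmaps _ h1).2.le⟩
    · rw [hFa _ h3, hGb _ h1]
      have := (hrE hr).2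
      linear_combination this + r ^ 2 * sin_sq_add_cos_sq θ
    · rw [Mfun_comp_eq hF hG ha hb hFa hGb ha' hb' h3 h1]
      field_simp
  have hae : ∀ᵐ θ ∂volume.restrict (Ioc (-(π / 2)) (π / 2)), θ ∈ Ioo (-(π / 2)) (π / 2) ∧ θ ≠ 0 := by
    rw [← Measure.restrict_congr_set Ioo_ae_eq_Ioc]
    filter_upwards [ae_restrict_mem measurableSet_Ioo,
      ae_restrict_of_ae (Measure.ae_ne volume (0 : ℝ))] with θ h1 h2 using ⟨h1, h2⟩
  have hsqrt : ∀ {E}, 0 < E → E < E₀ → √E ∈ Ioo 0 R ∧ T E = S (√E) := fun {E} h1 h2 => by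
    have h3 : √E ∈ Ioo 0 R := ⟨Real.sqrt_pos.2 h1, (Real.sqrt_lt' hR).2 (hRE ▸ h2)⟩
    refine ⟨h3, ?_⟩
    rw [← hTS h3, Real.sq_sqrt h1.le]
  constructor
  · intro hpos E₁ E₂ h1 h12 h2
    have hSmono : MonotoneOn S (Ioo 0 R) := by
      refine monotoneOn_of_deriv_nonneg (convex_Ioo _ _) hSc
        (fun r hr => ((hSd r (interior_subset hr)).differentiableAt).differentiableWithinAt)
        fun r hr => ?_
      have hr := interior_subset hr
      rw [(hSd r hr).deriv, intervalIntegral.integral_of_le hpi]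
      refine integral_nonneg_of_ae ?_
      filter_upwards [hae] with θ hθ
      obtain ⟨c, hc, x, hx, y, hy, hxy, hMxy⟩ := hM hr θ hθ.1 hθ.2
      exact nonneg_of_mul_nonneg_right (hMxy ▸ hpos x y hx hy hxy) hc
    obtain ⟨h3, h4⟩ := hsqrt h1 (h12.trans_lt h2)
    obtain ⟨h5, h6⟩ := hsqrt (h1.trans_le h12) h2
    rw [h4, h6]
    exact hSmono h3 h5 (Real.sqrt_le_sqrt h12)
  · intro hneg E₁ E₂ h1 h12 h2
    have hSanti : AntitoneOn S (Ioo 0 R) := by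
      refine antitoneOn_of_deriv_nonpos (convex_Ioo _ _) hSc
        (fun r hr => ((hSd r (interior_subset hr)).differentiableAt).differentiableWithinAt)
        fun r hr => ?_
      have hr := interior_subset hr
      rw [(hSd r hr).deriv, intervalIntegral.integral_of_le hpi]
      refine integral_nonpos_of_ae ?_
      filter_upwards [hae] with θ hθ
      obtain ⟨c, hc, x, hx, y, hy, hxy, hMxy⟩ := hM hr θ hθ.1 hθ.2
      exact nonpos_of_mul_nonpos_right (hMxy ▸ hneg x y hx hy hxy) hc
    obtain ⟨h3, h4⟩ := hsqrt h1 (h12.trans_lt h2)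
    obtain ⟨h5, h6⟩ := hsqrt (h1.trans_le h12) h2
    rw [h4, h6]
    exact hSanti h3 h5 (Real.sqrt_le_sqrt h12)
end

section
/- Suppose a ≠ 0, a²/4 < b ≤ a²/3 and c > 0. Assume A has a real root, let x₁ be a real root of A of minimal absolute value (which has sign opposite to a), and let x₀ ≠ x₁ satisfy F(x₀) = F(x₁). Assume moreover that B(x₀) > 0, A(x₀) > 0, and that 0 < c ≤ 2A(x₀)/(3B(x₀)). Then for every (x,y) lying in the region {(x,y) : x between x₁ and x₀, 0 ≤ F(x) + G(y) ≤ F(x₁)} one has A(x)P(y) − B(x)Q(y) ≥ 0; consequently M(x,y) ≥ 0 on this region. -/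
open Set

/-- `F(x) = x²/2 + a·x³/3 + b·x⁴/4`. -/
noncomputable def Fq (a b : ℝ) : ℝ → ℝ := fun x => x ^ 2 / 2 + a * x ^ 3 / 3 + b * x ^ 4 / 4

/-- `G(y) = y²/2 + c·y⁴/4`. -/
noncomputable def Gq (c : ℝ) : ℝ → ℝ := fun y => y ^ 2 / 2 + c * y ^ 4 / 4

/-- The function `M(x,y)` for the quartic Hamiltonian with parameters `a`, `b`, `c`. -/
noncomputable def Mq (a b c : ℝ) (x y : ℝ) : ℝ := Mfun (Fq a b) (Gq c) x y

/-- The polynomial `A(x)`. -/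
def Apoly (a b x : ℝ) : ℝ :=
  10 * a ^ 2 - 9 * b + a * (30 * b + 4 * a ^ 2) * x + b * (36 * b + 16 * a ^ 2) * x ^ 2
    + 24 * a * b ^ 2 * x ^ 3 + 9 * b ^ 3 * x ^ 4

/-- The polynomial `B(x)`. -/
def Bpoly (a b x : ℝ) : ℝ :=
  (6 + 4 * a * x + 3 * b * x ^ 2) * (1 + a * x + b * x ^ 2) ^ 2 * (1 + 2 * a * x + 3 * b * x ^ 2)

/-- The polynomial `P(y)`. -/
def Ppoly (c y : ℝ) : ℝ := (1 + c * y ^ 2) ^ 2 * (2 + c * y ^ 2)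

/-- The polynomial `Q(y)`. -/
def Qpoly (c y : ℝ) : ℝ := c * (3 + c * y ^ 2)

namespace QuarticHamiltonian

/-! For `a = 1` put `b = (1 - g ^ 2) / 3` and `x = (v - 1) / (1 - g ^ 2)`. Up to positive constants,
`A` becomes `scaledA g v` and the factors `6 + 4 * x + 3 * b * x ^ 2`, `1 + x + b * x ^ 2` and
`1 + 2 * x + 3 * b * x ^ 2` of `B` become `scaledP g v`, `scaledQ g v` and `v ^ 2 - g ^ 2`.
-/

/-- The polynomial `A` in the variables `g`, `v`. -/
def scaledA (g v : ℝ) : ℝ :=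
  v ^ 4 + 4 * v ^ 3 + (10 - 12 * g ^ 2) * v ^ 2 + (6 - 6 * g ^ 2) * v + 6 * g ^ 2 - 9 * g ^ 4

/-- The first factor of `B` in the variables `g`, `v`. -/
def scaledP (g v : ℝ) : ℝ := v ^ 2 + 2 * v + 3 - 6 * g ^ 2

/-- The second factor of `B` in the variables `g`, `v`. -/
def scaledQ (g v : ℝ) : ℝ := v ^ 2 + v + 1 - 3 * g ^ 2

/-- The polynomial `B` in the variables `g`, `v`. -/
def scaledB (g v : ℝ) : ℝ := scaledP g v * scaledQ g v ^ 2 * (v ^ 2 - g ^ 2)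

/-- The numerator of minus the derivative of `scaledA g / scaledB g` is nonnegative. -/
lemma numerator_nonneg {g v : ℝ} (hg : 0 ≤ g) (hg' : g ≤ 1 / 2) (hv : g ≤ v) :
    0 ≤ scaledA g v * ((2 * v + 2) * scaledQ g v * (v ^ 2 - g ^ 2)
        + 2 * scaledP g v * (2 * v + 1) * (v ^ 2 - g ^ 2)
        + scaledP g v * scaledQ g v * (2 * v))
      - (4 * v ^ 3 + 12 * v ^ 2 + 2 * (10 - 12 * g ^ 2) * v + (6 - 6 * g ^ 2))
        * scaledP g v * scaledQ g v * (v ^ 2 - g ^ 2) := by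
  obtain ⟨t, rfl⟩ : ∃ t, v = g + t := ⟨v - g, by ring⟩
  obtain ⟨h, hh⟩ : ∃ h, h = 1 - 2 * g := ⟨_, rfl⟩
  have ht : 0 ≤ t := by linarith
  have hh0 : 0 ≤ h := by linarith
  have key : 0 ≤
        t ^ 0 * (7744 * g ^ 9 + 31328 * h ^ 1 * g ^ 8 + 50692 * h ^ 2 * g ^ 7 +
          42100 * h ^ 3 * g ^ 6 + 19304 * h ^ 4 * g ^ 5 + 4936 * h ^ 5 * g ^ 4 +
          660 * h ^ 6 * g ^ 3 + 36 * h ^ 7 * g ^ 2) +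
        t ^ 1 * (39424 * g ^ 8 + 128320 * h ^ 1 * g ^ 7 + 163008 * h ^ 2 * g ^ 6 +
          104836 * h ^ 3 * g ^ 5 + 37552 * h ^ 4 * g ^ 4 + 7608 * h ^ 5 * g ^ 3 +
          816 * h ^ 6 * g ^ 2 + 36 * h ^ 7 * g ^ 1) +
        t ^ 2 * (77568 * g ^ 7 + 214840 * h ^ 1 * g ^ 6 + 227942 * h ^ 2 * g ^ 5 +
          120306 * h ^ 3 * g ^ 4 + 34804 * h ^ 4 * g ^ 3 + 5636 * h ^ 5 * g ^ 2 +
          486 * h ^ 6 * g ^ 1 + 18 * h ^ 7) +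
        t ^ 3 * (81984 * g ^ 6 + 193480 * h ^ 1 * g ^ 5 + 171502 * h ^ 2 * g ^ 4 +
          73936 * h ^ 3 * g ^ 3 + 16548 * h ^ 4 * g ^ 2 + 1832 * h ^ 5 * g ^ 1 +
          78 * h ^ 6) +
        t ^ 4 * (52628 * g ^ 5 + 103112 * h ^ 1 * g ^ 4 + 73268 * h ^ 2 * g ^ 3 +
          24228 * h ^ 3 * g ^ 2 + 3780 * h ^ 4 * g ^ 1 + 224 * h ^ 5) +
        t ^ 5 * (21592 * g ^ 4 + 33436 * h ^ 1 * g ^ 3 + 17596 * h ^ 2 * g ^ 2 +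
          3880 * h ^ 3 * g ^ 1 + 308 * h ^ 4) +
        t ^ 6 * (5722 * g ^ 3 + 6450 * h ^ 1 * g ^ 2 + 2200 * h ^ 2 * g ^ 1 + 236 * h ^ 3) +
        t ^ 7 * (954 * g ^ 2 + 672 * h ^ 1 * g ^ 1 + 112 * h ^ 2) +
        t ^ 8 * (92 * g ^ 1 + 28 * h ^ 1) +
        t ^ 9 * (4) := by positivity
  rw [hh] at key
  refine key.trans_eq ?_
  unfold scaledA scaledP scaledQ
  ring

lemma scaledP_pos {g v : ℝ} (hg : 0 ≤ g) (hg' : g < 1 / 2) : 0 < scaledP g v := by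
  unfold scaledP
  nlinarith [sq_nonneg (v + 1)]

lemma scaledQ_pos {g v : ℝ} (hg : 0 ≤ g) (hg' : g < 1 / 2) : 0 < scaledQ g v := by
  unfold scaledQ
  nlinarith [sq_nonneg (v + 1 / 2)]

lemma scaledB_pos {g v : ℝ} (hg : 0 ≤ g) (hg' : g < 1 / 2) (hv : g < v) : 0 < scaledB g v := by
  have hr : 0 < v ^ 2 - g ^ 2 := by nlinarith
  have hp := scaledP_pos (v := v) hg hg'
  have hq := scaledQ_pos (v := v) hg hg'
  unfold scaledB
  positivity

lemma hasDerivAt_scaledA (g v : ℝ) : HasDerivAt (scaledA g)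
    (4 * v ^ 3 + 12 * v ^ 2 + 2 * (10 - 12 * g ^ 2) * v + (6 - 6 * g ^ 2)) v := by
  have h := (((((hasDerivAt_id v).pow 4).add (((hasDerivAt_id v).pow 3).const_mul 4)).add
    (((hasDerivAt_id v).pow 2).const_mul (10 - 12 * g ^ 2))).add
    ((hasDerivAt_id v).const_mul (6 - 6 * g ^ 2))).add_const (6 * g ^ 2 - 9 * g ^ 4)
  refine (h.congr_deriv ?_).congr_of_eventuallyEq (Filter.Eventually.of_forall fun x => ?_)
  · simp; ring
  · simp [scaledA]; ring

lemma hasDerivAt_scaledP (g v : ℝ) : HasDerivAt (scaledP g) (2 * v + 2) v := by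
  have h := (((hasDerivAt_id v).pow 2).add ((hasDerivAt_id v).const_mul 2)).add_const
    (3 - 6 * g ^ 2)
  refine (h.congr_deriv ?_).congr_of_eventuallyEq (Filter.Eventually.of_forall fun x => ?_)
  · simp
  · simp [scaledP]; ring

lemma hasDerivAt_scaledQ (g v : ℝ) : HasDerivAt (scaledQ g) (2 * v + 1) v := by
  have h := (((hasDerivAt_id v).pow 2).add (hasDerivAt_id v)).add_const (1 - 3 * g ^ 2)
  refine (h.congr_deriv ?_).congr_of_eventuallyEq (Filter.Eventually.of_forall fun x => ?_)
  · simp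
  · simp [scaledQ]; ring

lemma antitoneOn_scaled_div {g : ℝ} (hg : 0 ≤ g) (hg' : g < 1 / 2) :
    AntitoneOn (fun v => scaledA g v / scaledB g v) (Ioi g) := by
  have hd : ∀ v ∈ Ioi g, HasDerivAt (fun v => scaledA g v / scaledB g v) _ v := fun v hv =>
    (hasDerivAt_scaledA g v).div
      (((hasDerivAt_scaledP g v).mul ((hasDerivAt_scaledQ g v).pow 2)).mul
        (((hasDerivAt_id v).pow 2).sub_const (g ^ 2)))
      (scaledB_pos hg hg' hv).ne'
  refine antitoneOn_of_deriv_nonpos (convex_Ioi g)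
    (fun v hv => (hd v hv).continuousAt.continuousWithinAt) ?_ ?_
  · rw [interior_Ioi]
    exact fun v hv => (hd v hv).differentiableAt.differentiableWithinAt
  · rw [interior_Ioi]
    intro v hv
    rw [(hd v hv).deriv]
    refine div_nonpos_of_nonpos_of_nonneg ?_ (sq_nonneg _)
    have h := mul_nonneg (scaledQ_pos (v := v) hg hg').le
      (numerator_nonneg hg hg'.le (le_of_lt hv))
    rw [← neg_nonneg]
    refine h.trans_eq ?_
    simp [scaledB]
    ring

/-- Dividing the variable by `a` reduces `A` to the case `a = 1`. -/
lemma Apoly_eq {a : ℝ} (ha : a ≠ 0) (b x : ℝ) :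
    Apoly a b x = a ^ 2 * Apoly 1 (b / a ^ 2) (a * x) := by
  unfold Apoly
  field_simp

lemma Bpoly_eq {a : ℝ} (ha : a ≠ 0) (b x : ℝ) :
    Bpoly a b x = Bpoly 1 (b / a ^ 2) (a * x) := by
  unfold Bpoly
  field_simp

lemma Fq_eq {a : ℝ} (ha : a ≠ 0) (b x : ℝ) :
    Fq a b x = Fq 1 (b / a ^ 2) (a * x) / a ^ 2 := by
  unfold Fq
  field_simp

lemma Apoly_one_eq {g : ℝ} (hg : 1 - g ^ 2 ≠ 0) (u : ℝ) :
    Apoly 1 ((1 - g ^ 2) / 3) u = scaledA g (1 + (1 - g ^ 2) * u) / (3 * (1 - g ^ 2)) := by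
  unfold Apoly scaledA
  field_simp
  ring

lemma Bpoly_one_eq {g : ℝ} (hg : 1 - g ^ 2 ≠ 0) (u : ℝ) :
    Bpoly 1 ((1 - g ^ 2) / 3) u = scaledB g (1 + (1 - g ^ 2) * u) / (9 * (1 - g ^ 2) ^ 4) := by
  have hp : 6 + 4 * 1 * u + 3 * ((1 - g ^ 2) / 3) * u ^ 2 =
      scaledP g (1 + (1 - g ^ 2) * u) / (1 - g ^ 2) := by
    unfold scaledP
    field_simp
    ring
  have hq : 1 + 1 * u + (1 - g ^ 2) / 3 * u ^ 2 =
      scaledQ g (1 + (1 - g ^ 2) * u) / (3 * (1 - g ^ 2)) := by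
    unfold scaledQ
    field_simp
    ring
  have hr : 1 + 2 * 1 * u + 3 * ((1 - g ^ 2) / 3) * u ^ 2 =
      ((1 + (1 - g ^ 2) * u) ^ 2 - g ^ 2) / (1 - g ^ 2) := by
    field_simp
    ring
  unfold Bpoly
  rw [hp, hq, hr]
  unfold scaledB
  field_simp
  ring

lemma Apoly_one_pos {β u : ℝ} (hβ : 0 < β) (hβ' : β ≤ 1 / 3) (hu : 0 ≤ u) :
    0 < Apoly 1 β u := by
  have h : 0 < 10 - 9 * β := by linarith
  have e : Apoly 1 β u = (10 - 9 * β) + (30 * β + 4) * u + β * (36 * β + 16) * u ^ 2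
      + 24 * β ^ 2 * u ^ 3 + 9 * β ^ 3 * u ^ 4 := by
    unfold Apoly
    ring
  rw [e]
  positivity

/-- A point of nonpositivity of `A` lies below its root of minimal absolute value. -/
lemma le_root_of_Apoly_nonpos {β u₁ u : ℝ} (hβ : 0 < β) (hβ' : β ≤ 1 / 3)
    (hu₁ : Apoly 1 β u₁ = 0) (hmin : ∀ u, Apoly 1 β u = 0 → |u₁| ≤ |u|)
    (hu : Apoly 1 β u ≤ 0) : u ≤ u₁ := by
  have neg : ∀ {w}, Apoly 1 β w ≤ 0 → w < 0 := fun hw => by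
    by_contra! h
    exact absurd (Apoly_one_pos hβ hβ' h) hw.not_gt
  have hcont : Continuous (Apoly 1 β) := by
    unfold Apoly
    fun_prop
  obtain ⟨z, hz, hz0⟩ := intermediate_value_Icc (neg hu).le hcont.continuousOn
    ⟨hu, (Apoly_one_pos hβ hβ' le_rfl).le⟩
  have := hmin z hz0
  rw [abs_of_neg (neg hu₁.le), abs_of_neg (neg hz0.le)] at this
  linarith [hz.1]

/-- `F` is injective on the negative half-line. -/
lemma Fq_one_ne {β u v : ℝ} (hβ : 1 / 4 < β) (huv : u < v) (hv : v < 0) :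
    Fq 1 β u ≠ Fq 1 β v := by
  obtain ⟨p, rfl⟩ : ∃ p, u = -p := ⟨-u, by ring⟩
  obtain ⟨q, rfl⟩ : ∃ q, v = -q := ⟨-v, by ring⟩
  have hq : 0 < q := by linarith
  have hp : 0 < p := by linarith
  have h1 : 0 < (p + q) / 2 - (p ^ 2 + p * q + q ^ 2) / 3
      + (p + q) * (p ^ 2 + q ^ 2) / 16 := by
    have h2 : 0 < 1 / 2 - (p + q) / 3 + (p + q) ^ 2 / 16 := by
      nlinarith [sq_nonneg (p + q - 8 / 3)]
    have h3 : 0 < (p - q) ^ 2 := pow_pos (by linarith) 2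
    refine pos_of_mul_pos_right (a := (p + q) ^ 2) ?_ (by positivity)
    have h4 : 0 < 2 * p * q * (p + q) * (1 - (p + q) / 4) ^ 2
        + (p - q) ^ 2 * (p + q) * (1 / 2 - (p + q) / 3 + (p + q) ^ 2 / 16) := by positivity
    refine h4.trans_eq ?_
    ring
  have h2 : 0 < (β - 1 / 4) * ((p + q) * (p ^ 2 + q ^ 2)) := by
    have : 0 < β - 1 / 4 := by linarith
    positivity
  have h3 : Fq 1 β (-p) - Fq 1 β (-q) =
      (p - q) * ((p + q) / 2 - (p ^ 2 + p * q + q ^ 2) / 3 + (p + q) * (p ^ 2 + q ^ 2) / 16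
        + (β - 1 / 4) * ((p + q) * (p ^ 2 + q ^ 2)) / 4) := by
    unfold Fq
    ring
  have h4 : 0 < Fq 1 β (-p) - Fq 1 β (-q) := by
    rw [h3]
    exact mul_pos (by linarith) (by linarith)
  exact (sub_pos.1 h4).ne'

/-- Between `u₁` and `u₀`, `A` is nonnegative, and `A / B` is at least its value at `u₀` where
`B` is positive. -/
lemma Apoly_one_bound {β u₁ u₀ u : ℝ} (hβ : 1 / 4 < β) (hβ' : β ≤ 1 / 3)
    (hu₁ : Apoly 1 β u₁ = 0) (hmin : ∀ u, Apoly 1 β u = 0 → |u₁| ≤ |u|)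
    (hne : u₀ ≠ u₁) (hF : Fq 1 β u₀ = Fq 1 β u₁) (hu : u ∈ uIcc u₁ u₀) :
    0 ≤ Apoly 1 β u ∧
      (0 < Bpoly 1 β u → Apoly 1 β u₀ * Bpoly 1 β u ≤ Apoly 1 β u * Bpoly 1 β u₀) := by
  have hβ0 : 0 < β := by linarith
  have hneg : u₁ < 0 := by
    by_contra! h
    exact (Apoly_one_pos hβ0 hβ' h).ne' hu₁
  have hlt : u₁ < u₀ := by
    by_contra! h
    exact Fq_one_ne hβ (lt_of_le_of_ne h hne) hneg hF
  rw [uIcc_of_le hlt.le] at hu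
  refine ⟨?_, fun hB => ?_⟩
  · by_contra! h
    have : u = u₁ := le_antisymm (le_root_of_Apoly_nonpos hβ0 hβ' hu₁ hmin h.le) hu.1
    rw [this, hu₁] at h
    exact lt_irrefl _ h
  obtain ⟨g, hg, hg2⟩ : ∃ g, 0 ≤ g ∧ g ^ 2 = 1 - 3 * β :=
    ⟨√(1 - 3 * β), Real.sqrt_nonneg _, Real.sq_sqrt (by linarith)⟩
  have hg' : g < 1 / 2 := by nlinarith
  have hw : 0 < 1 - g ^ 2 := by linarith
  obtain rfl : β = (1 - g ^ 2) / 3 := by linarith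
  have hlow : (-g - 1) / (1 - g ^ 2) ≤ u₁ := by
    refine le_root_of_Apoly_nonpos hβ0 hβ' hu₁ hmin ?_
    rw [Apoly_one_eq hw.ne', mul_div_cancel₀ _ hw.ne']
    refine div_nonpos_of_nonpos_of_nonneg ?_ (by positivity)
    have e : scaledA g (1 + (-g - 1)) = -(2 * g * (1 - 2 * g) * (3 - 5 * g) * (g + 1)) := by
      unfold scaledA
      ring
    rw [e, neg_nonpos]
    have h1 : 0 ≤ 1 - 2 * g := by linarith
    have h2 : 0 ≤ 3 - 5 * g := by linarith
    positivity
  rw [Bpoly_one_eq hw.ne'] at hB ⊢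
  rw [Bpoly_one_eq hw.ne', Apoly_one_eq hw.ne', Apoly_one_eq hw.ne']
  set v := 1 + (1 - g ^ 2) * u with hv
  set v₀ := 1 + (1 - g ^ 2) * u₀ with hv₀
  have hvv : v ≤ v₀ := by
    have := mul_le_mul_of_nonneg_left hu.2 hw.le
    linarith
  have hgv : g < v := by
    rw [div_le_iff₀ hw] at hlow
    have h1 : -g ≤ v := by
      have := mul_le_mul_of_nonneg_left hu.1 hw.le
      linarith
    have h2 : 0 < v ^ 2 - g ^ 2 := by
      by_contra! h
      have : scaledB g v ≤ 0 := mul_nonpos_of_nonneg_of_nonpos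
        (mul_nonneg (scaledP_pos hg hg').le (sq_nonneg _)) h
      exact absurd hB (div_nonpos_of_nonpos_of_nonneg this (by positivity)).not_gt
    nlinarith
  have h := antitoneOn_scaled_div hg hg' (mem_Ioi.2 hgv) (mem_Ioi.2 (hgv.trans_le hvv)) hvv
  have hle : scaledA g v₀ * scaledB g v ≤ scaledA g v * scaledB g v₀ :=
    (div_le_div_iff₀ (scaledB_pos hg hg' (hgv.trans_le hvv)) (scaledB_pos hg hg' hgv)).1 h
  rw [div_mul_div_comm, div_mul_div_comm]
  gcongr

lemma deriv_quartic (p q r s : ℝ) :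
    deriv (fun x : ℝ => p * x + q * x ^ 2 + r * x ^ 3 + s * x ^ 4) =
      fun x => p + 2 * q * x + 3 * r * x ^ 2 + 4 * s * x ^ 3 := by
  funext x
  have h := ((((hasDerivAt_id x).const_mul p).add (((hasDerivAt_id x).pow 2).const_mul q)).add
    (((hasDerivAt_id x).pow 3).const_mul r)).add (((hasDerivAt_id x).pow 4).const_mul s)
  refine (h.congr_deriv ?_).deriv
  simp
  ring

lemma deriv_Fq (a b : ℝ) : deriv (Fq a b) = fun x => x + a * x ^ 2 + b * x ^ 3 := by
  have e : Fq a b = fun x => 0 * x + 1 / 2 * x ^ 2 + a / 3 * x ^ 3 + b / 4 * x ^ 4 := by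
    funext x
    unfold Fq
    ring
  rw [e, deriv_quartic]
  funext x
  ring

lemma deriv_deriv_Fq (a b : ℝ) :
    deriv (deriv (Fq a b)) = fun x => 1 + 2 * a * x + 3 * b * x ^ 2 := by
  have e : deriv (Fq a b) = fun x => 1 * x + a * x ^ 2 + b * x ^ 3 + 0 * x ^ 4 := by
    rw [deriv_Fq]
    funext x
    ring
  rw [e, deriv_quartic]
  funext x
  ring

lemma deriv_deriv_deriv_Fq (a b : ℝ) :
    deriv (deriv (deriv (Fq a b))) = fun x => 2 * a + 6 * b * x := by
  have e : deriv (deriv (Fq a b)) =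
      fun x => 1 + (2 * a * x + 3 * b * x ^ 2 + 0 * x ^ 3 + 0 * x ^ 4) := by
    rw [deriv_deriv_Fq]
    funext x
    ring
  rw [e]
  funext x
  rw [deriv_const_add, deriv_quartic]
  ring

lemma Gq_eq_Fq (c : ℝ) : Gq c = Fq 0 c := by
  funext y
  unfold Gq Fq
  ring

lemma Mq_eq (a b c x y : ℝ) : Mq a b c x y =
    x ^ 4 * y ^ 4 / 24 * (Apoly a b x * Ppoly c y - Bpoly a b x * Qpoly c y) := by
  unfold Mq Mfun
  rw [Gq_eq_Fq, deriv_deriv_deriv_Fq, deriv_deriv_Fq, deriv_deriv_Fq, deriv_Fq, deriv_Fq]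
  unfold Fq Apoly Bpoly Ppoly Qpoly
  ring

lemma mul_Ppoly_sub_nonneg {A B c : ℝ} (hc : 0 ≤ c) (hA : 0 ≤ A) (h : 3 * c * B ≤ 2 * A)
    (y : ℝ) : 0 ≤ A * Ppoly c y - B * Qpoly c y := by
  unfold Ppoly Qpoly
  obtain ⟨s, hs⟩ : ∃ s, s = c * y ^ 2 := ⟨_, rfl⟩
  have hs0 : 0 ≤ s := hs ▸ by positivity
  rw [← hs]
  have h1 : 0 ≤ (2 * A - 3 * c * B) * (3 + s) := mul_nonneg (by linarith) (by linarith)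
  have h2 : 0 ≤ A * (s * (13 + 12 * s + 3 * s ^ 2)) := by positivity
  linear_combination (1 / 3) * h1 + (1 / 3) * h2

end QuarticHamiltonian

open QuarticHamiltonian in
theorem stmt11 (a b c : ℝ) (ha : a ≠ 0) (hb1 : a ^ 2 / 4 < b) (hb2 : b ≤ a ^ 2 / 3)
    (hcpos : 0 < c)
    (x₁ : ℝ) (hx₁ : Apoly a b x₁ = 0)
    (hx₁min : ∀ x : ℝ, Apoly a b x = 0 → |x₁| ≤ |x|)
    (x₀ : ℝ) (hx₀ : x₀ ≠ x₁) (hFx₀ : Fq a b x₀ = Fq a b x₁)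
    (hB₀ : 0 < Bpoly a b x₀) (hA₀ : 0 < Apoly a b x₀)
    (hc : c ≤ 2 * Apoly a b x₀ / (3 * Bpoly a b x₀)) :
    ∀ x y : ℝ, x ∈ Set.uIcc x₁ x₀ → 0 ≤ Fq a b x + Gq c y → Fq a b x + Gq c y ≤ Fq a b x₁ →
      0 ≤ Apoly a b x * Ppoly c y - Bpoly a b x * Qpoly c y ∧ 0 ≤ Mq a b c x y := by
  intro x y hx _ _
  have ha2 : 0 < a ^ 2 := by positivity
  have hβ : 1 / 4 < b / a ^ 2 := by
    rw [lt_div_iff₀ ha2]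
    linarith
  have hβ' : b / a ^ 2 ≤ 1 / 3 := by
    rw [div_le_iff₀ ha2]
    linarith
  have hroot : ∀ z, Apoly a b z = 0 ↔ Apoly 1 (b / a ^ 2) (a * z) = 0 := fun z => by
    rw [Apoly_eq ha, mul_eq_zero, or_iff_right ha2.ne']
  have hmin : ∀ u, Apoly 1 (b / a ^ 2) u = 0 → |a * x₁| ≤ |u| := fun u hu => by
    have h := hx₁min (u / a) ((hroot _).2 (by rwa [mul_div_cancel₀ _ ha]))
    rwa [abs_div, le_div_iff₀ (abs_pos.2 ha), mul_comm, ← abs_mul] at h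
  have hF : Fq 1 (b / a ^ 2) (a * x₀) = Fq 1 (b / a ^ 2) (a * x₁) := by
    rwa [Fq_eq ha, Fq_eq ha b x₁, div_left_inj' ha2.ne'] at hFx₀
  have hmem : a * x ∈ uIcc (a * x₁) (a * x₀) := by
    rw [← image_const_mul_uIcc]
    exact mem_image_of_mem _ hx
  obtain ⟨hA, hAB⟩ := Apoly_one_bound hβ hβ' ((hroot _).1 hx₁) hmin
    (fun h => hx₀ (mul_left_cancel₀ ha h)) hF hmem
  have hA' : 0 ≤ Apoly a b x := by
    rw [Apoly_eq ha]
    positivity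
  have hcB : 3 * c * Bpoly a b x ≤ 2 * Apoly a b x := by
    rcases le_or_gt (Bpoly a b x) 0 with hB | hB
    · nlinarith
    · rw [← Bpoly_eq ha, ← Bpoly_eq ha] at hAB
      have h1 := mul_le_mul_of_nonneg_left (hAB hB) ha2.le
      rw [← mul_assoc, ← mul_assoc, ← Apoly_eq ha, ← Apoly_eq ha] at h1
      rw [le_div_iff₀ (by positivity)] at hc
      refine le_of_mul_le_mul_right ?_ hB₀
      nlinarith
  have h := mul_Ppoly_sub_nonneg hcpos.le hA' hcB y
  refine ⟨h, ?_⟩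
  rw [Mq_eq]
  positivity
end
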